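/- arXiv:1608.05056 — 2 statements merged into one kernel-verified Lean document; each statement's English description precedes it below -/
import Mathlib

section
/- The four-element set of Pascal lines {ℓ_1, ℓ_2, ℓ_3, ℓ_*} is optimal: the subfield of K = ℚ(a,b,c,d,e,f) generated over ℚ by all eight line coordinates s_1,t_1,s_2,t_2,s_3,t_3,s_*,t_* equals K, but for every proper subset of {ℓ_1, ℓ_2, ℓ_3, ℓ_*} the subfield of K generated over ℚ by the line coordinates of the lines in that subset is a proper subfield of K. -/
noncomputable section

/-- `K = ℚ(a,b,c,d,e,f)`, the field of rational functions in six variables over ℚ. -/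
abbrev RatField : Type := FractionRing (MvPolynomial (Fin 6) ℚ)

/-- The six independent variables `a, b, c, d, e, f` (indexed `0,…,5`) as elements of
`ℚ(a,…,f)`. -/
def var (i : Fin 6) : RatField :=
  algebraMap (MvPolynomial (Fin 6) ℚ) RatField (MvPolynomial.X i)

/-- The point `[1, p, p²]` of the conic `z1² = z0·z2`, in homogeneous coordinates. -/
def conicPt (p : RatField) : Fin 3 → RatField := ![1, p, p ^ 2]

/-- Cross product of coordinate vectors: the coordinates of the join of two points, or of
the intersection of two lines. -/
def cross (u v : Fin 3 → RatField) : Fin 3 → RatField :=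
  ![u 1 * v 2 - u 2 * v 1, u 2 * v 0 - u 0 * v 2, u 0 * v 1 - u 1 * v 0]

/-- The homogeneous coordinate vector of the Pascal line of the array
`[P1 P2 P3; Q1 Q2 Q3]` of points of the conic with parameters `p1, p2, p3, q1, q2, q3`:
the line through the (collinear) points `P1Q2 ∩ P2Q1`, `P2Q3 ∩ P3Q2`, `P1Q3 ∩ P3Q1`,
computed as the join of the first two of them. -/
def pascalVec (p1 p2 p3 q1 q2 q3 : RatField) : Fin 3 → RatField :=
  cross
    (cross (cross (conicPt p1) (conicPt q2)) (cross (conicPt p2) (conicPt q1)))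
    (cross (cross (conicPt p2) (conicPt q3)) (cross (conicPt p3) (conicPt q2)))

/-- The coordinate `s` of a line with coordinates `⟨1, s, t⟩`, i.e. the line
`z0 + s·z1 + t·z2 = 0`. -/
def sCoord (l : Fin 3 → RatField) : RatField := l 1 / l 0

/-- The coordinate `t` of a line with coordinates `⟨1, s, t⟩`, i.e. the line
`z0 + s·z1 + t·z2 = 0`. -/
def tCoord (l : Fin 3 → RatField) : RatField := l 2 / l 0

/-- The Pascal `ℓ₁` of the array `[A D B; E C F]`. -/
def line1 : Fin 3 → RatField := pascalVec (var 0) (var 3) (var 1) (var 4) (var 2) (var 5)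

/-- The Pascal `ℓ₂` of the array `[A C F; E D B]`. -/
def line2 : Fin 3 → RatField := pascalVec (var 0) (var 2) (var 5) (var 4) (var 3) (var 1)

/-- The Pascal `ℓ₃` of the array `[A D F; E C B]`. -/
def line3 : Fin 3 → RatField := pascalVec (var 0) (var 3) (var 5) (var 4) (var 2) (var 1)

/-- The Pascal `ℓ⋆` of the array `[A B C; F D E]`. -/
def lineStar : Fin 3 → RatField :=
  pascalVec (var 0) (var 1) (var 2) (var 5) (var 3) (var 4)

/-- The pair `(s, t)` of line coordinates of the `i`-th of the four Pascal lines
`ℓ₁, ℓ₂, ℓ₃, ℓ⋆`. -/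
def lineCoords : Fin 4 → RatField × RatField :=
  ![(sCoord line1, tCoord line1), (sCoord line2, tCoord line2),
    (sCoord line3, tCoord line3), (sCoord lineStar, tCoord lineStar)]

open MvPolynomial

/-- The quadratic form of the fixed points of the homography `p i ↦ p (i + 3)`, `i = 0, 1, 2`. -/
def axisForm {R : Type*} [CommRing R] (p : Fin 6 → R) : Fin 3 → R :=
  ![(p 3 - p 5) * (p 1 - p 2) * (p 4 * p 0) - (p 0 - p 2) * (p 4 - p 5) * (p 1 * p 3),
    (p 0 - p 2) * (p 4 - p 5) * (p 1 + p 3) - (p 3 - p 5) * (p 1 - p 2) * (p 4 + p 0),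
    (p 3 - p 5) * (p 1 - p 2) - (p 0 - p 2) * (p 4 - p 5)]

/-- The arrays defining the four Pascal lines. -/
def pascalArray : Fin 4 → Fin 6 → Fin 6 :=
  ![![0, 3, 1, 4, 2, 5], ![0, 2, 5, 4, 3, 1], ![0, 3, 5, 4, 2, 1], ![0, 1, 2, 5, 3, 4]]

/-- The reduced coordinate vector of the `i`-th Pascal line of the sextuple `x`. -/
def lineForm {R : Type*} [CommRing R] (x : Fin 6 → R) (i : Fin 4) : Fin 3 → R :=
  axisForm (x ∘ pascalArray i)

lemma map_axisForm {R S : Type*} [CommRing R] [CommRing S] (f : R →+* S) (p : Fin 6 → R)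
    (k : Fin 3) : f (axisForm p k) = axisForm (f ∘ p) k := by
  fin_cases k <;> simp [axisForm]

lemma map_lineForm {R S : Type*} [CommRing R] [CommRing S] (f : R →+* S) (x : Fin 6 → R)
    (i : Fin 4) (k : Fin 3) : f (lineForm x i k) = lineForm (f ∘ x) i k :=
  map_axisForm f _ k

lemma var_injective : Function.Injective var := fun _ _ h ↦
  X_injective (IsFractionRing.injective (MvPolynomial (Fin 6) ℚ) RatField h)

lemma pascalVec_eq (p : Fin 6 → RatField) (k : Fin 3) :
    pascalVec (p 0) (p 1) (p 2) (p 3) (p 4) (p 5) k =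
      (p 0 - p 4) * (p 1 - p 3) * (p 1 - p 5) * (p 2 - p 4) * (p 1 - p 4) * axisForm p k := by
  fin_cases k <;> simp [pascalVec, cross, conicPt, axisForm] <;> ring

lemma pascalVec_div {p : Fin 6 → RatField} (hp : Function.Injective p) (k : Fin 3) :
    pascalVec (p 0) (p 1) (p 2) (p 3) (p 4) (p 5) k /
      pascalVec (p 0) (p 1) (p 2) (p 3) (p 4) (p 5) 0 = axisForm p k / axisForm p 0 := by
  have h {i j : Fin 6} (hij : i ≠ j) : p i - p j ≠ 0 := sub_ne_zero.2 (hp.ne hij)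
  rw [pascalVec_eq, pascalVec_eq, mul_div_mul_left]
  refine mul_ne_zero (mul_ne_zero (mul_ne_zero (mul_ne_zero ?_ ?_) ?_) ?_) ?_ <;>
    exact h (by decide)

lemma pascalArray_injective (i : Fin 4) : Function.Injective (pascalArray i) := by
  revert i
  unfold Function.Injective
  decide

lemma lineCoords_eq (i : Fin 4) : lineCoords i =
    (lineForm var i 1 / lineForm var i 0, lineForm var i 2 / lineForm var i 0) := by
  have h := pascalVec_div (var_injective.comp (pascalArray_injective i))
  ext
  · exact Eq.trans (by fin_cases i <;> rfl) (h 1)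
  · exact Eq.trans (by fin_cases i <;> rfl) (h 2)

lemma algebraMap_ne_zero {P : MvPolynomial (Fin 6) ℚ} (r : Fin 6 → ℚ) (h : eval r P ≠ 0) :
    algebraMap (MvPolynomial (Fin 6) ℚ) RatField P ≠ 0 := by
  intro h0
  rw [map_eq_zero_iff _ (IsFractionRing.injective _ RatField)] at h0
  exact h (by simp [h0])

lemma lineForm_var_eq (i : Fin 4) (k : Fin 3) : lineForm var i k =
    algebraMap (MvPolynomial (Fin 6) ℚ) RatField (lineForm X i k) :=
  (map_lineForm _ _ _ _).symm

lemma eval_lineForm_X (r : Fin 6 → ℚ) (i : Fin 4) (k : Fin 3) :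
    eval r (lineForm X i k) = lineForm r i k := by
  rw [map_lineForm]
  congr 1
  ext j
  simp

lemma lineForm_var_zero_ne_zero (i : Fin 4) : lineForm var i 0 ≠ 0 := by
  rw [lineForm_var_eq]
  refine algebraMap_ne_zero ![1, 2, 4, 8, 17, 33] ?_
  rw [eval_lineForm_X]
  fin_cases i <;> simp [lineForm, axisForm, pascalArray] <;> norm_num

/-- The automorphism of `RatField` permuting the variables. -/
def permAut (e : Equiv.Perm (Fin 6)) : RatField ≃+* RatField :=
  IsFractionRing.ringEquivOfRingEquiv (renameEquiv ℚ e).toRingEquiv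

lemma permAut_var (e : Equiv.Perm (Fin 6)) (i : Fin 6) : permAut e (var i) = var (e i) := by
  unfold permAut var
  rw [IsFractionRing.ringEquivOfRingEquiv_algebraMap]
  simp

lemma permAut_lineForm (e : Equiv.Perm (Fin 6)) (i : Fin 4) (k : Fin 3) :
    permAut e (lineForm var i k) = axisForm (var ∘ e ∘ pascalArray i) k := by
  have h := map_lineForm (permAut e : RatField →+* RatField) var i k
  simp only [RingHom.coe_coe] at h
  rw [h, lineForm]
  congr 1
  ext j
  simp [permAut_var]

/-- The set of line coordinates of the Pascal lines with indices in `X`. -/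
def coordSet (X : Set (Fin 4)) : Set RatField :=
  ⋃ i ∈ X, {(lineCoords i).1, (lineCoords i).2}

lemma coordSet_mono {X Y : Set (Fin 4)} (h : X ⊆ Y) : coordSet X ⊆ coordSet Y :=
  Set.biUnion_subset_biUnion_left h

/-- The row-swapping involution `(A E)(B F)(C D)`. -/
def swapPerm : Equiv.Perm (Fin 6) := Equiv.swap 0 4 * Equiv.swap 1 5 * Equiv.swap 2 3

/-- The permutation `(A C B)(D F E)`. -/
def cyclePerm : Equiv.Perm (Fin 6) where
  toFun := ![2, 0, 1, 5, 3, 4]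
  invFun := ![1, 2, 0, 4, 5, 3]
  left_inv := by decide
  right_inv := by decide

lemma axisForm_swapPerm {R : Type*} [CommRing R] (x : Fin 6 → R) {i : Fin 4} (hi : i ≠ 3)
    (k : Fin 3) : axisForm (x ∘ swapPerm ∘ pascalArray i) k = -lineForm x i k := by
  have hs : ⇑swapPerm = ![4, 5, 3, 2, 0, 1] := by decide
  rw [hs]
  fin_cases i <;> first | exact absurd rfl hi | skip
  all_goals fin_cases k <;> simp [lineForm, axisForm, pascalArray]

lemma axisForm_cyclePerm {R : Type*} [CommRing R] (x : Fin 6 → R) (i : Fin 4) (k : Fin 3) :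
    axisForm (x ∘ cyclePerm ∘ pascalArray i) k =
      (![1, -1, -1, 1] : Fin 4 → R) i * lineForm x ((![1, 2, 0, 3] : Fin 4 → Fin 4) i) k := by
  have hs : ⇑cyclePerm = ![2, 0, 1, 5, 3, 4] := rfl
  rw [hs]
  fin_cases i <;> fin_cases k <;> simp [lineForm, axisForm, pascalArray] <;> ring

lemma lineCoords_swapPerm {i : Fin 4} (hi : i ≠ 3) :
    permAut swapPerm (lineCoords i).1 = (lineCoords i).1 ∧
      permAut swapPerm (lineCoords i).2 = (lineCoords i).2 := by
  simp only [lineCoords_eq, map_div₀, permAut_lineForm, axisForm_swapPerm _ hi,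
    neg_div_neg_eq, and_self]

lemma lineCoords_cyclePerm (i : Fin 4) :
    permAut cyclePerm (lineCoords i).1 =
        (lineCoords ((![1, 2, 0, 3] : Fin 4 → Fin 4) i)).1 ∧
      permAut cyclePerm (lineCoords i).2 =
        (lineCoords ((![1, 2, 0, 3] : Fin 4 → Fin 4) i)).2 := by
  have h : (![1, -1, -1, 1] : Fin 4 → RatField) i ≠ 0 := by
    fin_cases i <;> simp
  simp only [lineCoords_eq, map_div₀, permAut_lineForm, axisForm_cyclePerm,
    mul_div_mul_left _ _ h, and_self]

lemma coordSet_swapPerm_fixed {X : Set (Fin 4)} (hX : 3 ∉ X) :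
    Subfield.closure (coordSet X) ≤
      (permAut swapPerm : RatField →+* RatField).eqLocusField (RingHom.id _) := by
  rw [Subfield.closure_le]
  refine Set.iUnion₂_subset fun i hi ↦ ?_
  have h := lineCoords_swapPerm (i := i) (by rintro rfl; exact hX hi)
  rintro x (rfl | rfl)
  · exact h.1
  · exact h.2

lemma closure_coordSet_ne_top_of_three {X : Set (Fin 4)} (hX : 3 ∉ X) :
    Subfield.closure (coordSet X) ≠ ⊤ := by
  intro h
  have h0 : permAut swapPerm (var 0) = var 0 :=
    coordSet_swapPerm_fixed hX (h ▸ Subfield.mem_top (var 0))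
  rw [permAut_var] at h0
  exact absurd (var_injective h0) (by decide)

lemma closure_coordSet_cyclePerm {X : Set (Fin 4)} (h : Subfield.closure (coordSet X) = ⊤) :
    Subfield.closure (coordSet ((![1, 2, 0, 3] : Fin 4 → Fin 4) '' X)) = ⊤ := by
  rw [eq_top_iff]
  have h2 := RingHom.map_field_closure (permAut cyclePerm : RatField →+* RatField) (coordSet X)
  rintro x -
  obtain ⟨y, rfl⟩ := (permAut cyclePerm).surjective x
  have hy : permAut cyclePerm y ∈ (Subfield.closure (coordSet X)).map
      (permAut cyclePerm : RatField →+* RatField) :=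
    ⟨y, h ▸ Subfield.mem_top y, rfl⟩
  rw [h2] at hy
  refine Subfield.closure_mono ?_ hy
  rintro _ ⟨z, hz, rfl⟩
  obtain ⟨i, hi, hz⟩ := Set.mem_iUnion₂.1 hz
  refine Set.mem_iUnion₂.2 ⟨_, Set.mem_image_of_mem _ hi, ?_⟩
  rcases hz with rfl | rfl
  · exact Or.inl (lineCoords_cyclePerm i).1
  · exact Or.inr (lineCoords_cyclePerm i).2

/-- The index of the line and of the entry of its coordinate vector giving the `j`-th of the
six coordinates of `ℓ₁, ℓ₂, ℓ⋆`. -/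
def coordIndex : Fin 6 → Fin 4 × Fin 3 := ![(0, 1), (0, 2), (1, 1), (1, 2), (3, 1), (3, 2)]

/-- The line coordinates of `ℓ₁, ℓ₂, ℓ⋆` as functions of the sextuple. -/
def coordMap {F : Type*} [Field F] (x : Fin 6 → F) (j : Fin 6) : F :=
  lineForm x (coordIndex j).1 (coordIndex j).2 / lineForm x (coordIndex j).1 0

/-- The pairs of a rational function and its value at the point `r`. -/
def valueGraph (r : Fin 6 → ℝ) : Subalgebra ℚ (RatField × ℝ) where
  carrier := {z | ∃ n d : MvPolynomial (Fin 6) ℚ, aeval r d ≠ 0 ∧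
    z.1 * algebraMap _ RatField d = algebraMap _ RatField n ∧ z.2 * aeval r d = aeval r n}
  mul_mem' := by
    rintro ⟨k, v⟩ ⟨k', v'⟩ ⟨n, d, hd, h1, h2⟩ ⟨n', d', hd', h1', h2'⟩
    refine ⟨n * n', d * d', ?_, ?_, ?_⟩
    · simpa using ⟨hd, hd'⟩
    · simp only [map_mul, Prod.mk_mul_mk] at *
      rw [← h1, ← h1']
      ring
    · simp only [map_mul, Prod.mk_mul_mk] at *
      rw [← h2, ← h2']
      ring
  add_mem' := by
    rintro ⟨k, v⟩ ⟨k', v'⟩ ⟨n, d, hd, h1, h2⟩ ⟨n', d', hd', h1', h2'⟩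
    refine ⟨n * d' + n' * d, d * d', ?_, ?_, ?_⟩
    · simpa using ⟨hd, hd'⟩
    · simp only [map_mul, map_add, Prod.mk_add_mk] at *
      rw [← h1, ← h1']
      ring
    · simp only [map_mul, map_add, Prod.mk_add_mk] at *
      rw [← h2, ← h2']
      ring
  algebraMap_mem' := fun c ↦ by
    refine ⟨C c, 1, by simp, ?_, by simp⟩
    simp only [map_one, mul_one, Prod.algebraMap_apply]
    exact IsScalarTower.algebraMap_apply ℚ (MvPolynomial (Fin 6) ℚ) RatField c

lemma algebraMap_mem_valueGraph (r : Fin 6 → ℝ) (P : MvPolynomial (Fin 6) ℚ) :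
    (algebraMap _ RatField P, aeval r P) ∈ valueGraph r :=
  ⟨P, 1, by simp, by simp, by simp⟩

lemma inv_mem_valueGraph {r : Fin 6 → ℝ} {k : RatField} {v : ℝ} (h : (k, v) ∈ valueGraph r)
    (hv : v ≠ 0) : (k⁻¹, v⁻¹) ∈ valueGraph r := by
  obtain ⟨n, d, hd, h1, h2⟩ := h
  simp only at h1 h2
  have hn : aeval r n ≠ 0 := h2 ▸ mul_ne_zero hv hd
  have hk : k ≠ 0 := by
    rintro rfl
    rw [zero_mul, eq_comm, map_eq_zero_iff _ (IsFractionRing.injective _ RatField)] at h1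
    simp [h1] at hn
  refine ⟨d, n, hn, ?_, ?_⟩
  · simp only [← h1]
    rw [inv_mul_cancel_left₀ hk]
  · simp only [← h2]
    rw [inv_mul_cancel_left₀ hv]

lemma eq_of_mem_valueGraph {r : Fin 6 → ℝ} {k : RatField} {v w : ℝ} (hv : (k, v) ∈ valueGraph r)
    (hw : (k, w) ∈ valueGraph r) : v = w := by
  obtain ⟨n, d, hd, h1, h2⟩ := (valueGraph r).sub_mem hv hw
  simp only [Prod.mk_sub_mk, sub_self, zero_mul] at h1 h2
  rw [eq_comm, map_eq_zero_iff _ (IsFractionRing.injective _ RatField)] at h1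
  rw [h1, map_zero, mul_eq_zero] at h2
  exact sub_eq_zero.1 (h2.resolve_right hd)

lemma aeval_mem_valueGraph {ι : Type*} {r : Fin 6 → ℝ} {y : ι → RatField} {g : ι → ℝ}
    (h : ∀ j, (y j, g j) ∈ valueGraph r) (P : MvPolynomial ι ℚ) :
    (aeval y P, aeval g P) ∈ valueGraph r := by
  induction P using MvPolynomial.induction_on with
  | C a => simpa using (valueGraph r).algebraMap_mem a
  | add p q hp hq => simpa using (valueGraph r).add_mem hp hq
  | mul_X p i hp => simpa using (valueGraph r).mul_mem hp (h i)

lemma lineForm_mem_valueGraph (r : Fin 6 → ℝ) (i : Fin 4) (k : Fin 3) :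
    (lineForm var i k, lineForm r i k) ∈ valueGraph r := by
  have h := algebraMap_mem_valueGraph r (lineForm X i k)
  have h2 := map_lineForm (aeval r : MvPolynomial (Fin 6) ℚ →ₐ[ℚ] ℝ).toRingHom X i k
  have h3 : ((aeval r : MvPolynomial (Fin 6) ℚ →ₐ[ℚ] ℝ).toRingHom : _ → ℝ) ∘ X = r := by
    ext j
    simp
  rw [h3] at h2
  rw [← lineForm_var_eq] at h
  exact h2 ▸ h

lemma coordMap_mem_valueGraph {r : Fin 6 → ℝ}
    (hr : ∀ j, lineForm r (coordIndex j).1 0 ≠ 0) (j : Fin 6) :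
    (coordMap var j, coordMap r j) ∈ valueGraph r := by
  simp only [coordMap, div_eq_mul_inv]
  exact (valueGraph r).mul_mem (lineForm_mem_valueGraph _ _ _)
    (inv_mem_valueGraph (lineForm_mem_valueGraph _ _ _) (hr j))

/-- An element of the subfield generated by a family is a quotient of polynomials in it. -/
lemma exists_aeval_div_of_mem_closure {ι : Type*} {y : ι → RatField} {x : RatField}
    (hx : x ∈ Subfield.closure (Set.range y)) :
    ∃ N D : MvPolynomial ι ℚ, aeval y D ≠ 0 ∧ x * aeval y D = aeval y N := by
  have key : ∀ z ∈ Subring.closure (Set.range y), ∃ P : MvPolynomial ι ℚ, aeval y P = z := by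
    intro z hz
    have hle : Subring.closure (Set.range y) ≤
        (aeval y : MvPolynomial ι ℚ →ₐ[ℚ] _).toRingHom.range := by
      rw [Subring.closure_le]
      rintro _ ⟨i, rfl⟩
      exact ⟨X i, by simp⟩
    exact hle hz
  obtain ⟨n, hn, d, hd, rfl⟩ := Subfield.mem_closure_iff.1 hx
  by_cases h0 : d = 0
  · exact ⟨0, 1, by simp, by simp [h0]⟩
  · obtain ⟨N, rfl⟩ := key n hn
    obtain ⟨D, rfl⟩ := key d hd
    exact ⟨N, D, h0, div_mul_cancel₀ _ h0⟩

lemma eq_zero_of_eventually_aeval_eq_zero {ι : Type*} [Fintype ι] {D : MvPolynomial ι ℚ}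
    {z : ι → ℝ} (h : ∀ᶠ w in nhds z, aeval w D = 0) : D = 0 := by
  obtain ⟨ε, hε, hb⟩ := Metric.eventually_nhds_iff_ball.1 h
  have hs : ∀ i, (Metric.ball (z i) ε).Infinite := fun i ↦ by
    rw [Real.ball_eq_Ioo]
    exact Set.Ioo_infinite (by linarith)
  have h0 : map (algebraMap ℚ ℝ) D = 0 := by
    refine funext_set _ hs fun w hw ↦ ?_
    rw [eval_map, ← aeval_def, map_zero]
    exact hb w (by rwa [ball_pi z hε])
  exact map_injective _ (algebraMap ℚ ℝ).injective (by rw [h0, map_zero])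

/-- A family of rational functions whose value maps are open at two distinct points with the
same image does not generate `RatField`. -/
lemma closure_range_ne_top {ι : Type*} [Fintype ι] {y : ι → RatField}
    {g : (Fin 6 → ℝ) → ι → ℝ} {p q : Fin 6 → ℝ}
    (hp : ∀ᶠ r in nhds p, ∀ j, (y j, g r j) ∈ valueGraph r)
    (hq : ∀ᶠ r in nhds q, ∀ j, (y j, g r j) ∈ valueGraph r)
    (hgp : Filter.map g (nhds p) = nhds (g p)) (hgq : Filter.map g (nhds q) = nhds (g q))
    (hpq : g p = g q) (hne : p ≠ q) : Subfield.closure (Set.range y) ≠ ⊤ := by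
  intro htop
  obtain ⟨i, hi⟩ := Function.ne_iff.1 hne
  obtain ⟨N, D, hD, hND⟩ := exists_aeval_div_of_mem_closure (htop ▸ Subfield.mem_top (var i))
  have hval {r : Fin 6 → ℝ} (hr : ∀ j, (y j, g r j) ∈ valueGraph r) :
      r i * aeval (g r) D = aeval (g r) N := by
    have hX := algebraMap_mem_valueGraph r (X i)
    have h1 := (valueGraph r).mul_mem hX (aeval_mem_valueGraph hr D)
    have h2 := aeval_mem_valueGraph hr N
    rw [← hND] at h2
    rw [aeval_X] at h1
    exact eq_of_mem_valueGraph h1 h2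
  obtain ⟨U, V, hU, hV, hpU, hqV, hUV⟩ := t2_separation hi
  have hpU' : ∀ᶠ r in nhds p, r i ∈ U := (continuous_apply i).continuousAt (hU.mem_nhds hpU)
  have hqV' : ∀ᶠ r in nhds q, r i ∈ V := (continuous_apply i).continuousAt (hV.mem_nhds hqV)
  have h1 := Filter.image_mem_map (m := g) (hp.and hpU')
  have h2 := Filter.image_mem_map (m := g) (hq.and hqV')
  rw [hgp] at h1
  rw [hgq, ← hpq] at h2
  refine hD ?_
  rw [eq_zero_of_eventually_aeval_eq_zero (D := D) (z := g p), map_zero]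
  filter_upwards [h1, h2]
  rintro _ ⟨r, ⟨hr, hrU⟩, rfl⟩ ⟨r', ⟨hr', hrV⟩, hrr⟩
  have e1 := hval hr
  have e2 := hval hr'
  rw [hrr, ← e1, ← sub_eq_zero, ← sub_mul, mul_eq_zero, sub_eq_zero] at e2
  refine e2.resolve_left fun h ↦ ?_
  exact Set.disjoint_left.1 hUV hrU (h ▸ hrV)

lemma contDiff_lineForm (i : Fin 4) (k : Fin 3) :
    ContDiff ℝ 1 fun x : Fin 6 → ℝ ↦ lineForm x i k := by
  fin_cases k <;> simp only [lineForm, axisForm, Function.comp_apply] <;> dsimp <;> fun_prop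

lemma lineForm_add_single {R : Type*} [CommRing R] (x : Fin 6 → R) (i : Fin 4) (k : Fin 3)
    (j : Fin 6) (t : R) : lineForm (x + t • Pi.single j 1) i k =
      lineForm x i k + t * (lineForm (x + Pi.single j 1) i k - lineForm x i k) := by
  fin_cases i <;> fin_cases k <;> fin_cases j <;>
    simp [lineForm, axisForm, pascalArray] <;> ring

lemma hasStrictFDerivAt_coordMap {p : Fin 6 → ℝ}
    (hp : ∀ j, lineForm p (coordIndex j).1 0 ≠ 0) :
    HasStrictFDerivAt coordMap (fderiv ℝ coordMap p) p := by
  have h : ContDiffAt ℝ 1 (coordMap : (Fin 6 → ℝ) → Fin 6 → ℝ) p :=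
    contDiffAt_pi.2 fun j ↦ (contDiff_lineForm _ _).contDiffAt.div
      (contDiff_lineForm _ _).contDiffAt (hp j)
  exact h.hasStrictFDerivAt one_ne_zero

/-- The Jacobian matrix of `coordMap`; the partial derivatives of a quotient of multi-affine
functions are difference quotients. -/
def coordJacobian {F : Type*} [Field F] (x : Fin 6 → F) : Matrix (Fin 6) (Fin 6) F := fun k j ↦
  (lineForm (x + Pi.single j 1) (coordIndex k).1 (coordIndex k).2 *
      lineForm x (coordIndex k).1 0 -
    lineForm x (coordIndex k).1 (coordIndex k).2 *
      lineForm (x + Pi.single j 1) (coordIndex k).1 0) /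
    lineForm x (coordIndex k).1 0 ^ 2

lemma map_coordJacobian {F G : Type*} [Field F] [Field G] (f : F →+* G) (x : Fin 6 → F) :
    (coordJacobian x).map f = coordJacobian (f ∘ x) := by
  have h (j : Fin 6) : f ∘ (x + Pi.single j 1) = f ∘ x + Pi.single j 1 := by
    ext i
    simp [Pi.single_apply, apply_ite f]
  ext k j
  simp [coordJacobian, map_lineForm, h]

lemma map_coordMap {F G : Type*} [Field F] [Field G] (f : F →+* G) (x : Fin 6 → F)
    (j : Fin 6) : f (coordMap x j) = coordMap (f ∘ x) j := by
  simp [coordMap, map_lineForm]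

lemma fderiv_coordMap_single {p : Fin 6 → ℝ} (hp : ∀ j, lineForm p (coordIndex j).1 0 ≠ 0)
    (j k : Fin 6) : fderiv ℝ coordMap p (Pi.single j 1) k = coordJacobian p k j := by
  have h1 := hasDerivAt_pi.1
    ((hasStrictFDerivAt_coordMap hp).hasFDerivAt.hasLineDerivAt (Pi.single j 1)) k
  have haff (m : Fin 3) : HasDerivAt
      (fun t : ℝ ↦ lineForm (p + t • Pi.single j 1) (coordIndex k).1 m)
      (lineForm (p + Pi.single j 1) (coordIndex k).1 m - lineForm p (coordIndex k).1 m) 0 := by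
    simp only [lineForm_add_single p _ _ j]
    simpa using ((hasDerivAt_id (0 : ℝ)).mul_const (lineForm (p + Pi.single j 1)
      (coordIndex k).1 m - lineForm p (coordIndex k).1 m)).const_add
      (lineForm p (coordIndex k).1 m)
  have h2 := (haff (coordIndex k).2).div (haff 0) (by simpa using hp k)
  rw [h1.unique h2]
  simp only [zero_smul, add_zero, coordJacobian]
  congr 1
  ring

lemma map_coordMap_nhds {x : Fin 6 → ℚ} {N : Matrix (Fin 6) (Fin 6) ℚ}
    (hx : ∀ j, lineForm (Rat.castHom ℝ ∘ x) (coordIndex j).1 0 ≠ 0)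
    (hN : N * coordJacobian x = 1) :
    Filter.map coordMap (nhds (Rat.castHom ℝ ∘ x)) = nhds (coordMap (Rat.castHom ℝ ∘ x)) := by
  refine (hasStrictFDerivAt_coordMap hx).map_nhds_eq_of_surj (LinearMap.range_eq_top.2 ?_)
  refine LinearMap.injective_iff_surjective.1 ((injective_iff_map_eq_zero _).2 fun v hv ↦ ?_)
  have hJ : (coordJacobian (Rat.castHom ℝ ∘ x)).mulVec v = 0 := by
    ext k
    have hsum : v = ∑ j, v j • (Pi.single j 1 : Fin 6 → ℝ) := by
      conv_lhs => rw [← Finset.univ_sum_single v]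
      simp only [← Pi.single_smul, smul_eq_mul, mul_one]
    have h := congrFun hv k
    rw [hsum, map_sum, Finset.sum_apply] at h
    refine Eq.trans ?_ h
    simp only [Matrix.mulVec, dotProduct]
    refine Finset.sum_congr rfl fun j _ ↦ ?_
    rw [map_smul, Pi.smul_apply, smul_eq_mul, mul_comm, ContinuousLinearMap.coe_coe,
      fderiv_coordMap_single hx]
  have hN' : N.map (Rat.castHom ℝ) * coordJacobian (Rat.castHom ℝ ∘ x) = 1 := by
    rw [← map_coordJacobian, ← Matrix.map_mul, hN, Matrix.map_one _ (map_zero _) (map_one _)]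
  rw [← Matrix.one_mulVec v, ← hN', ← Matrix.mulVec_mulVec, hJ, Matrix.mulVec_zero]

lemma eventually_coordMap_mem_valueGraph {p : Fin 6 → ℝ}
    (hp : ∀ j, lineForm p (coordIndex j).1 0 ≠ 0) :
    ∀ᶠ r in nhds p, ∀ j, (coordMap var j, coordMap r j) ∈ valueGraph r := by
  have h : ∀ᶠ r in nhds p, ∀ j, lineForm r (coordIndex j).1 0 ≠ 0 :=
    Filter.eventually_all.2 fun j ↦
      (contDiff_lineForm _ _).continuous.continuousAt.eventually_ne (hp j)
  exact h.mono fun r hr j ↦ coordMap_mem_valueGraph hr j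

/-- The coordinates of `ℓ₁, ℓ₂, ℓ⋆` agree at two points where their Jacobian is invertible. -/
lemma closure_coordMap_ne_top : Subfield.closure (Set.range (coordMap var)) ≠ ⊤ := by
  have hne {x : Fin 6 → ℚ} (hx : ∀ j, lineForm x (coordIndex j).1 0 ≠ 0) (j : Fin 6) :
      lineForm (Rat.castHom ℝ ∘ x) (coordIndex j).1 0 ≠ 0 := by
    rw [← map_lineForm]
    exact (map_ne_zero _).2 (hx j)
  have hp : ∀ j, lineForm (![-2, 1, -1, 0, 2, 1] : Fin 6 → ℚ) (coordIndex j).1 0 ≠ 0 := by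
    decide +kernel
  have hq : ∀ j, lineForm (![0, 1, 2, -2, -1, 1] : Fin 6 → ℚ) (coordIndex j).1 0 ≠ 0 := by
    decide +kernel
  have hp' : (!![-27078/66209, -20058/66209, 98838/66209, -19098/66209, 1072/5093, 2608/5093;
      -1/52, -1/52, 27/52, 27/52, 0, 0;
      2131/66209, -1561/66209, 18981/66209, -77895/66209, 153/5093, -768/5093;
      -10035/264836, -13155/264836, 22281/264836, 74697/264836, -685/5093, 842/5093;
      -12366/66209, -30462/66209, 3942/66209, -168750/66209, 4480/5093, -4912/5093;
      -3/13, -3/13, 3/13, 3/13, 0, 0] : Matrix (Fin 6) (Fin 6) ℚ) *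
      coordJacobian ![-2, 1, -1, 0, 2, 1] = 1 := by
    decide +kernel
  have hq' : (!![3830/66209, 3050/66209, 14214/66209, 27318/66209, -685/5093, 842/5093;
      8/13, 8/13, 18/13, 18/13, 0, 0;
      -33376/66209, -51472/66209, -24708/66209, -197400/66209, 4480/5093, -4912/5093;
      97948/66209, 104968/66209, 269328/66209, 151392/66209, 1072/5093, 2608/5093;
      -19220/66209, -22912/66209, -10134/66209, -107010/66209, 153/5093, -768/5093;
      2/39, 2/39, 8/13, 8/13, 0, 0] : Matrix (Fin 6) (Fin 6) ℚ) *
      coordJacobian ![0, 1, 2, -2, -1, 1] = 1 := by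
    decide +kernel
  have hpq : ∀ j, coordMap (![-2, 1, -1, 0, 2, 1] : Fin 6 → ℚ) j =
      coordMap ![0, 1, 2, -2, -1, 1] j := by
    decide +kernel
  refine closure_range_ne_top (eventually_coordMap_mem_valueGraph (hne hp))
    (eventually_coordMap_mem_valueGraph (hne hq)) (map_coordMap_nhds (hne hp) hp')
    (map_coordMap_nhds (hne hq) hq') ?_ ?_
  · ext j
    rw [← map_coordMap, ← map_coordMap, hpq]
  · intro h
    have := congrFun h 0
    norm_num at this

lemma closure_coordSet_compl_two_ne_top : Subfield.closure (coordSet {2}ᶜ) ≠ ⊤ := by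
  intro h
  refine closure_coordMap_ne_top (eq_top_iff.2 (h ▸ Subfield.closure_mono ?_))
  refine Set.iUnion₂_subset fun i hi ↦ ?_
  rw [lineCoords_eq]
  rintro x (rfl | rfl)
  · fin_cases i
    · exact ⟨0, rfl⟩
    · exact ⟨2, rfl⟩
    · exact absurd rfl hi
    · exact ⟨4, rfl⟩
  · fin_cases i
    · exact ⟨1, rfl⟩
    · exact ⟨3, rfl⟩
    · exact absurd rfl hi
    · exact ⟨5, rfl⟩

lemma closure_coordSet_ne_top {X : Set (Fin 4)} {i : Fin 4} (hi : i ∉ X) :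
    Subfield.closure (coordSet X) ≠ ⊤ := by
  have h2 {X : Set (Fin 4)} (hX : 2 ∉ X) : Subfield.closure (coordSet X) ≠ ⊤ := fun h ↦
    closure_coordSet_compl_two_ne_top (eq_top_iff.2 (h ▸ Subfield.closure_mono
      (coordSet_mono fun j hj ↦ by rintro rfl; exact hX hj)))
  have h1 {X : Set (Fin 4)} (hX : 1 ∉ X) : Subfield.closure (coordSet X) ≠ ⊤ := fun h ↦ by
    refine h2 ?_ (closure_coordSet_cyclePerm h)
    rintro ⟨j, hj, h⟩
    fin_cases j <;> simp_all
  fin_cases i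
  · intro h
    refine h1 ?_ (closure_coordSet_cyclePerm h)
    rintro ⟨j, hj, h⟩
    fin_cases j <;> simp_all
  · exact h1 hi
  · exact h2 hi
  · exact closure_coordSet_ne_top_of_three hi

/-- The indices of the points on two secants meeting at `ℓ₁ ∩ ℓ₃`, `ℓ₁ ∩ ℓ₂`, `ℓ₂ ∩ ℓ₃`. -/
def secantArray : Fin 3 → Fin 4 → Fin 6 := ![![0, 2, 4, 3], ![1, 2, 5, 3], ![0, 1, 4, 5]]

/-- The indices of the lines meeting at `ℓ₁ ∩ ℓ₃`, `ℓ₁ ∩ ℓ₂`, `ℓ₂ ∩ ℓ₃`. -/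
def meetLines : Fin 3 → Fin 4 × Fin 4 := ![(0, 2), (0, 1), (1, 2)]

/-- The intersection of the secants `p 0 p 1` and `p 2 p 3` of the conic. -/
def secantMeet {R : Type*} [CommRing R] (p : Fin 4 → R) : Fin 3 → R :=
  ![p 2 + p 3 - p 0 - p 1, p 2 * p 3 - p 0 * p 1,
    p 2 * p 3 * (p 0 + p 1) - p 0 * p 1 * (p 2 + p 3)]

/-- The coordinate vectors of `ℓ₁ ∩ ℓ₃`, `ℓ₁ ∩ ℓ₂`, `ℓ₂ ∩ ℓ₃`. -/
def meetForm {R : Type*} [CommRing R] (x : Fin 6 → R) (m : Fin 3) : Fin 3 → R :=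
  secantMeet (x ∘ secantArray m)

lemma map_secantMeet {R S : Type*} [CommRing R] [CommRing S] (f : R →+* S) (p : Fin 4 → R)
    (k : Fin 3) : f (secantMeet p k) = secantMeet (f ∘ p) k := by
  fin_cases k <;> simp [secantMeet]

lemma meetForm_var_eq (m k : Fin 3) : meetForm var m k =
    algebraMap (MvPolynomial (Fin 6) ℚ) RatField (meetForm X m k) :=
  (map_secantMeet _ _ _).symm

lemma eval_meetForm_X (r : Fin 6 → ℚ) (m k : Fin 3) :
    eval r (meetForm X m k) = meetForm r m k := by
  rw [meetForm, map_secantMeet]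
  congr 1
  ext j
  simp

lemma meetForm_var_zero_ne_zero (m : Fin 3) : meetForm var m 0 ≠ 0 := by
  rw [meetForm_var_eq]
  refine algebraMap_ne_zero ![1, 2, 4, 8, 17, 33] ?_
  rw [eval_meetForm_X]
  revert m
  decide +kernel

lemma lineForm_meetForm {R : Type*} [CommRing R] (x : Fin 6 → R) (m : Fin 3) :
    lineForm x (meetLines m).1 0 * meetForm x m 0 +
        lineForm x (meetLines m).1 1 * meetForm x m 1 +
        lineForm x (meetLines m).1 2 * meetForm x m 2 = 0 ∧
      lineForm x (meetLines m).2 0 * meetForm x m 0 +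
        lineForm x (meetLines m).2 1 * meetForm x m 1 +
        lineForm x (meetLines m).2 2 * meetForm x m 2 = 0 := by
  fin_cases m <;> constructor <;>
    simp [meetLines, meetForm, secantMeet, secantArray, lineForm, axisForm, pascalArray] <;> ring

/-- The affine coordinates of `ℓ₁ ∩ ℓ₃`, `ℓ₁ ∩ ℓ₂`, `ℓ₂ ∩ ℓ₃`. -/
def meetCoord (m k : Fin 3) : RatField := meetForm var m k / meetForm var m 0

lemma lineCoords_mem {X : Set (Fin 4)} {i : Fin 4} (hi : i ∈ X) :
    (lineCoords i).1 ∈ Subfield.closure (coordSet X) ∧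
      (lineCoords i).2 ∈ Subfield.closure (coordSet X) :=
  ⟨Subfield.subset_closure (Set.mem_iUnion₂.2 ⟨i, hi, Or.inl rfl⟩),
    Subfield.subset_closure (Set.mem_iUnion₂.2 ⟨i, hi, Or.inr rfl⟩)⟩

lemma mem_of_two_lines {K : Type*} [Field K] {F : Subfield K} {s t s' t' u v : K}
    (hs : s ∈ F) (ht : t ∈ F) (hs' : s' ∈ F) (ht' : t' ∈ F)
    (h : 1 + s * u + t * v = 0) (h' : 1 + s' * u + t' * v = 0) (hd : s * t' - t * s' ≠ 0) :
    u ∈ F ∧ v ∈ F := by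
  have hu : u = (t - t') / (s * t' - t * s') := by
    rw [eq_div_iff hd]
    linear_combination t' * h - t * h'
  have hv : v = (s' - s) / (s * t' - t * s') := by
    rw [eq_div_iff hd]
    linear_combination s * h' - s' * h
  have hdF := F.sub_mem (F.mul_mem hs ht') (F.mul_mem ht hs')
  exact ⟨hu ▸ F.div_mem (F.sub_mem ht ht') hdF, hv ▸ F.div_mem (F.sub_mem hs' hs) hdF⟩

lemma lineCoords_det_ne_zero (m : Fin 3) :
    (lineCoords (meetLines m).1).1 * (lineCoords (meetLines m).2).2 -
      (lineCoords (meetLines m).1).2 * (lineCoords (meetLines m).2).1 ≠ 0 := by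
  have h : lineForm var (meetLines m).1 1 * lineForm var (meetLines m).2 2 -
      lineForm var (meetLines m).1 2 * lineForm var (meetLines m).2 1 ≠ 0 := by
    simp only [lineForm_var_eq, ← map_mul, ← map_sub]
    refine algebraMap_ne_zero ![1, 2, 4, 8, 17, 33] ?_
    simp only [map_sub, map_mul, eval_lineForm_X]
    revert m
    decide +kernel
  simp only [lineCoords_eq]
  rw [div_mul_div_comm, div_mul_div_comm, ← sub_div]
  exact div_ne_zero h (mul_ne_zero (lineForm_var_zero_ne_zero _) (lineForm_var_zero_ne_zero _))

lemma meetCoord_mem (m : Fin 3) : meetCoord m 1 ∈ Subfield.closure (coordSet {3}ᶜ) ∧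
    meetCoord m 2 ∈ Subfield.closure (coordSet {3}ᶜ) := by
  have h1 : (meetLines m).1 ∈ ({3}ᶜ : Set (Fin 4)) := by fin_cases m <;> simp [meetLines]
  have h2 : (meetLines m).2 ∈ ({3}ᶜ : Set (Fin 4)) := by fin_cases m <;> simp [meetLines]
  have key {i : Fin 4} (h : lineForm var i 0 * meetForm var m 0 +
      lineForm var i 1 * meetForm var m 1 + lineForm var i 2 * meetForm var m 2 = 0) :
      1 + (lineCoords i).1 * meetCoord m 1 + (lineCoords i).2 * meetCoord m 2 = 0 := by
    have hl := lineForm_var_zero_ne_zero i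
    have hm := meetForm_var_zero_ne_zero m
    rw [lineCoords_eq]
    unfold meetCoord
    field_simp
    linear_combination h
  exact mem_of_two_lines (lineCoords_mem h1).1 (lineCoords_mem h1).2 (lineCoords_mem h2).1
    (lineCoords_mem h2).2 (key (lineForm_meetForm var m).1) (key (lineForm_meetForm var m).2)
    (lineCoords_det_ne_zero m)

/-- The point `ℓᵢ ∩ ℓⱼ` lies on the two secants through it. -/
lemma secant_left (m : Fin 3) :
    var (secantArray m 0) * var (secantArray m 1) -
      meetCoord m 1 * (var (secantArray m 0) + var (secantArray m 1)) + meetCoord m 2 = 0 := by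
  have hm := meetForm_var_zero_ne_zero m
  unfold meetCoord
  field_simp
  simp [meetForm, secantMeet]
  ring

lemma secant_right (m : Fin 3) :
    var (secantArray m 2) * var (secantArray m 3) -
      meetCoord m 1 * (var (secantArray m 2) + var (secantArray m 3)) + meetCoord m 2 = 0 := by
  have hm := meetForm_var_zero_ne_zero m
  unfold meetCoord
  field_simp
  simp [meetForm, secantMeet]
  ring

lemma secantArray_injective (m : Fin 3) : Function.Injective (secantArray m) := by
  revert m
  unfold Function.Injective
  decide

lemma var_sub_meetCoord_ne_zero (m : Fin 3) (j : Fin 4) :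
    var (secantArray m j) - meetCoord m 1 ≠ 0 := by
  have hm := meetForm_var_zero_ne_zero m
  have h {i j : Fin 4} (hij : i ≠ j) : var (secantArray m i) - var (secantArray m j) ≠ 0 :=
    sub_ne_zero.2 ((var_injective.comp (secantArray_injective m)).ne hij)
  have e : (var (secantArray m j) - meetCoord m 1) * meetForm var m 0 =
      var (secantArray m j) * meetForm var m 0 - meetForm var m 1 := by
    unfold meetCoord
    field_simp
  refine left_ne_zero_of_mul (b := meetForm var m 0) (e ▸ ?_)
  have h02 := h (show (0 : Fin 4) ≠ 2 by decide)
  have h03 := h (show (0 : Fin 4) ≠ 3 by decide)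
  have h12 := h (show (1 : Fin 4) ≠ 2 by decide)
  have h13 := h (show (1 : Fin 4) ≠ 3 by decide)
  fin_cases j
  · convert neg_ne_zero.2 (mul_ne_zero h02 h03) using 1
    simp [meetForm, secantMeet]
    ring
  · convert neg_ne_zero.2 (mul_ne_zero h12 h13) using 1
    simp [meetForm, secantMeet]
    ring
  · convert mul_ne_zero h02 h12 using 1
    simp [meetForm, secantMeet]
    ring
  · convert mul_ne_zero h03 h13 using 1
    simp [meetForm, secantMeet]
    ring

lemma mem_of_secant {K : Type*} [Field K] {F : Subfield K} {x y u v : K} (hx : x ∈ F)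
    (hu : u ∈ F) (hv : v ∈ F) (h : x * y - u * (x + y) + v = 0) (hne : x - u ≠ 0) : y ∈ F := by
  have hy : y = (u * x - v) / (x - u) := by
    rw [eq_div_iff hne]
    linear_combination h
  exact hy ▸ F.div_mem (F.sub_mem (F.mul_mem hu hx) hv) (F.sub_mem hx hu)

/-- The coefficients of the quadratic equation satisfied by a vertex of a triangle inscribed in
the conic whose sides pass through three given points. -/
def triangleQuad {R : Type*} [CommRing R] (u v : Fin 3 → R) : Fin 3 → R :=
  ![u 1 * u 0 - v 1 - u 2 * u 0 + u 2 * u 1,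
    v 1 * u 0 - u 1 * v 0 - u 2 * (u 1 * u 0 - v 0 + (u 1 * u 0 - v 1)) + v 2 * (u 0 - u 1),
    v 2 * (u 1 * u 0 - v 0) - u 2 * (v 1 * u 0 - u 1 * v 0)]

lemma triangleQuad_eq_zero {R : Type*} [CommRing R] {u v : Fin 3 → R} {a b c : R}
    (h0 : a * c - u 0 * (a + c) + v 0 = 0) (h1 : b * c - u 1 * (b + c) + v 1 = 0)
    (h2 : a * b - u 2 * (a + b) + v 2 = 0) :
    triangleQuad u v 0 * a ^ 2 + triangleQuad u v 1 * a + triangleQuad u v 2 = 0 := by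
  simp only [triangleQuad, Matrix.cons_val]
  linear_combination (c * (a - u 0) - u 1 * (a - u 0)) * h2 +
    (u 2 * a - v 2 - u 1 * (a - u 2)) * h0 - (a - u 0) * (a - u 2) * h1

lemma triangleQuad_meetCoord_ne_zero :
    triangleQuad (meetCoord · 1) (meetCoord · 2) 0 ≠ 0 := by
  have h : meetForm var 1 1 * meetForm var 0 1 * meetForm var 2 0 -
      meetForm var 1 2 * meetForm var 0 0 * meetForm var 2 0 -
      meetForm var 2 1 * meetForm var 0 1 * meetForm var 1 0 +
      meetForm var 2 1 * meetForm var 1 1 * meetForm var 0 0 ≠ 0 := by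
    simp only [meetForm_var_eq, ← map_mul, ← map_sub, ← map_add]
    refine algebraMap_ne_zero ![1, 2, 4, 8, 17, 33] ?_
    simp only [map_add, map_sub, map_mul, eval_meetForm_X]
    decide +kernel
  have h0 := meetForm_var_zero_ne_zero 0
  have h1 := meetForm_var_zero_ne_zero 1
  have h2 := meetForm_var_zero_ne_zero 2
  refine left_ne_zero_of_mul (b := meetForm var 0 0 * meetForm var 1 0 * meetForm var 2 0) ?_
  convert h using 1
  simp only [triangleQuad, Matrix.cons_val, meetCoord]
  field_simp

lemma triangleQuad_mem {K : Type*} [Field K] {F : Subfield K} {u v : Fin 3 → K}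
    (hu : ∀ m, u m ∈ F) (hv : ∀ m, v m ∈ F) (k : Fin 3) : triangleQuad u v k ∈ F := by
  let u' : Fin 3 → F := fun m ↦ ⟨u m, hu m⟩
  let v' : Fin 3 → F := fun m ↦ ⟨v m, hv m⟩
  have h : triangleQuad u v k = ((triangleQuad u' v' k : F) : K) := by
    fin_cases k <;> simp [triangleQuad, u', v']
  exact h ▸ (triangleQuad u' v' k).2

lemma var_zero_quad : triangleQuad (meetCoord · 1) (meetCoord · 2) 0 * var 0 ^ 2 +
    triangleQuad (meetCoord · 1) (meetCoord · 2) 1 * var 0 +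
    triangleQuad (meetCoord · 1) (meetCoord · 2) 2 = 0 :=
  triangleQuad_eq_zero (secant_left 0) (secant_left 1) (secant_left 2)

lemma var_four_quad : triangleQuad (meetCoord · 1) (meetCoord · 2) 0 * var 4 ^ 2 +
    triangleQuad (meetCoord · 1) (meetCoord · 2) 1 * var 4 +
    triangleQuad (meetCoord · 1) (meetCoord · 2) 2 = 0 :=
  triangleQuad_eq_zero (secant_right 0) (secant_right 1) (secant_right 2)

lemma eq_top_of_var_mem {F : Subfield RatField} (h : ∀ i, var i ∈ F) : F = ⊤ := by
  have hP (P : MvPolynomial (Fin 6) ℚ) : algebraMap _ RatField P ∈ F := by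
    induction P using MvPolynomial.induction_on with
    | C a =>
      have : algebraMap (MvPolynomial (Fin 6) ℚ) RatField (C a) = (a : RatField) := by
        rw [← eq_ratCast (algebraMap ℚ RatField) a]
        exact (IsScalarTower.algebraMap_apply ℚ (MvPolynomial (Fin 6) ℚ) RatField a).symm
      exact this ▸ SubfieldClass.ratCast_mem F a
    | add p q hp hq => exact map_add (algebraMap _ RatField) p q ▸ F.add_mem hp hq
    | mul_X p i hp => exact map_mul (algebraMap _ RatField) p (X i) ▸ F.mul_mem hp (h i)
  rw [eq_top_iff]
  rintro x -
  obtain ⟨n, d, -, rfl⟩ := IsFractionRing.div_surjective (A := MvPolynomial (Fin 6) ℚ) x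
  exact F.div_mem (hP n) (hP d)

lemma eq_top_of_var_zero_mem {F : Subfield RatField}
    (hF : Subfield.closure (coordSet {3}ᶜ) ≤ F) (h0 : var 0 ∈ F) : F = ⊤ := by
  have hu (m : Fin 3) : meetCoord m 1 ∈ F := hF (meetCoord_mem m).1
  have hv (m : Fin 3) : meetCoord m 2 ∈ F := hF (meetCoord_mem m).2
  have hT := triangleQuad_mem hu hv
  have hne := triangleQuad_meetCoord_ne_zero
  have h4 : var 4 ∈ F := by
    have h04 : var 0 - var 4 ≠ 0 := sub_ne_zero.2 (var_injective.ne (by decide))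
    have e : var 4 = -triangleQuad (meetCoord · 1) (meetCoord · 2) 1 /
        triangleQuad (meetCoord · 1) (meetCoord · 2) 0 - var 0 := by
      rw [eq_sub_iff_add_eq, eq_div_iff hne]
      refine mul_right_cancel₀ h04 ?_
      linear_combination var_zero_quad - var_four_quad
    exact e ▸ F.sub_mem (F.div_mem (F.neg_mem (hT 1)) (hT 0)) h0
  have h2 : var 2 ∈ F :=
    mem_of_secant h0 (hu 0) (hv 0) (secant_left 0) (var_sub_meetCoord_ne_zero 0 0)
  have h1 : var 1 ∈ F :=
    mem_of_secant h0 (hu 2) (hv 2) (secant_left 2) (var_sub_meetCoord_ne_zero 2 0)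
  have h3 : var 3 ∈ F :=
    mem_of_secant h4 (hu 0) (hv 0) (secant_right 0) (var_sub_meetCoord_ne_zero 0 2)
  have h5 : var 5 ∈ F :=
    mem_of_secant h4 (hu 2) (hv 2) (secant_right 2) (var_sub_meetCoord_ne_zero 2 2)
  refine eq_top_of_var_mem fun i ↦ ?_
  fin_cases i <;> assumption

lemma swapPerm_lineCoords_three_ne :
    permAut swapPerm (lineCoords 3).1 ≠ (lineCoords 3).1 := by
  have hmap (k : Fin 3) : axisForm (var ∘ swapPerm ∘ pascalArray 3) k =
      algebraMap (MvPolynomial (Fin 6) ℚ) RatField (axisForm (X ∘ swapPerm ∘ pascalArray 3) k) :=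
    (map_axisForm _ _ _).symm
  have heval (k : Fin 3) : eval (![1, 2, 4, 8, 17, 33] : Fin 6 → ℚ)
      (axisForm (X ∘ swapPerm ∘ pascalArray 3) k) =
        axisForm (![1, 2, 4, 8, 17, 33] ∘ swapPerm ∘ pascalArray 3) k := by
    rw [map_axisForm]
    congr 1
    ext j
    simp
  have h0 : axisForm (var ∘ swapPerm ∘ pascalArray 3) 0 ≠ 0 := by
    rw [hmap]
    refine algebraMap_ne_zero ![1, 2, 4, 8, 17, 33] ?_
    rw [heval]
    decide +kernel
  simp only [lineCoords_eq, map_div₀, permAut_lineForm]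
  rw [ne_eq, div_eq_div_iff h0 (lineForm_var_zero_ne_zero 3), ← sub_eq_zero]
  simp only [hmap, lineForm_var_eq, ← map_mul, ← map_sub]
  refine algebraMap_ne_zero ![1, 2, 4, 8, 17, 33] ?_
  simp only [map_mul, map_sub, heval, eval_lineForm_X]
  decide +kernel

/-- A subfield over which a generator is quadratic is maximal. -/
lemma eq_top_of_quadratic {K : Type*} [Field K] {F E : Subfield K} {x k l n y : K}
    (hk : k ∈ F) (hl : l ∈ F) (hn : n ∈ F) (hk0 : k ≠ 0) (hx : k * x ^ 2 + l * x + n = 0)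
    (hgen : ∀ E : Subfield K, F ≤ E → x ∈ E → E = ⊤) (hFE : F ≤ E) (hyE : y ∈ E)
    (hyF : y ∉ F) : E = ⊤ := by
  let P : Polynomial F := Polynomial.C ⟨k, hk⟩ * Polynomial.X ^ 2 +
    Polynomial.C ⟨l, hl⟩ * Polynomial.X + Polynomial.C ⟨n, hn⟩
  have hk0' : (⟨k, hk⟩ : F) ≠ 0 := fun h ↦ hk0 (congrArg Subtype.val h)
  have hdeg : P.natDegree = 2 := Polynomial.natDegree_quadratic hk0'
  have hP0 : P ≠ 0 := by
    rintro h
    simp [h] at hdeg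
  have hroot : Polynomial.aeval x P = 0 := by
    simp only [P, map_add, map_mul, map_pow, Polynomial.aeval_C, Polynomial.aeval_X]
    exact hx
  have hint : IsIntegral F x := IsAlgebraic.isIntegral ⟨P, hP0, hroot⟩
  have htop : IntermediateField.adjoin F {x} = ⊤ := by
    have h := hgen (IntermediateField.adjoin F {x}).toSubfield
      (fun z hz ↦ (IntermediateField.adjoin F {x}).algebraMap_mem ⟨z, hz⟩)
      (IntermediateField.mem_adjoin_simple_self F x)
    rw [eq_top_iff]
    rintro z -
    have hz : z ∈ (IntermediateField.adjoin F {x}).toSubfield := h ▸ Subfield.mem_top z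
    exact hz
  have hfin : FiniteDimensional F K := by
    have := IntermediateField.adjoin.finiteDimensional hint
    rw [htop] at this
    exact Module.Finite.equiv IntermediateField.topEquiv.toLinearEquiv
  have hrank : Module.finrank F K ≤ 2 := by
    rw [← IntermediateField.finrank_top', ← htop, IntermediateField.adjoin.finrank hint, ← hdeg]
    exact Polynomial.natDegree_le_of_dvd (minpoly.dvd F x hroot) hP0
  have hE : Subfield.extendScalars hFE = ⊤ := by
    refine IntermediateField.eq_of_le_of_finrank_le le_top ?_
    have hpos : 0 < Module.finrank F (Subfield.extendScalars hFE) := Module.finrank_pos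
    have hne : Module.finrank F (Subfield.extendScalars hFE) ≠ 1 := fun h ↦ by
      rw [IntermediateField.finrank_eq_one_iff] at h
      have hy : y ∈ Subfield.extendScalars hFE := hyE
      rw [h, IntermediateField.mem_bot] at hy
      obtain ⟨z, rfl⟩ := hy
      exact hyF z.2
    rw [IntermediateField.finrank_top']
    omega
  rw [eq_top_iff]
  rintro z -
  have hz : z ∈ Subfield.extendScalars hFE := hE ▸ IntermediateField.mem_top
  exact hz

lemma closure_coordSet_univ : Subfield.closure (coordSet Set.univ) = ⊤ := by
  have hT := triangleQuad_mem (fun m ↦ (meetCoord_mem m).1) (fun m ↦ (meetCoord_mem m).2)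
  refine eq_top_of_quadratic (hT 0) (hT 1) (hT 2) triangleQuad_meetCoord_ne_zero var_zero_quad
    (fun E ↦ eq_top_of_var_zero_mem) (Subfield.closure_mono (coordSet_mono (Set.subset_univ _)))
    (lineCoords_mem (Set.mem_univ 3)).1 fun h ↦ ?_
  exact swapPerm_lineCoords_three_ne (coordSet_swapPerm_fixed (by simp) h)

/-- The set `{ℓ₁, ℓ₂, ℓ₃, ℓ⋆}` of Pascal lines is optimal: the subfield of
`K = ℚ(a,…,f)` generated over ℚ by all eight line coordinates equals `K`, but for every
proper subset the subfield generated over ℚ by the line coordinates of the lines in it is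
a proper subfield of `K`. -/
theorem pascal_stmt_5 :
    Subfield.closure (⋃ i ∈ (Set.univ : Set (Fin 4)),
        {(lineCoords i).1, (lineCoords i).2}) = (⊤ : Subfield RatField) ∧
      ∀ X : Set (Fin 4), X ⊂ Set.univ →
        Subfield.closure (⋃ i ∈ X, {(lineCoords i).1, (lineCoords i).2}) ≠
          (⊤ : Subfield RatField) := by
  refine ⟨closure_coordSet_univ, fun X hX ↦ ?_⟩
  obtain ⟨i, hi⟩ := (Set.ne_univ_iff_exists_notMem X).1 hX.ne
  exact closure_coordSet_ne_top hi

end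
end

section
/- Let a_x, b_x, c_x, d_x, e_x, f_x be six linear binary forms over a field of characteristic zero and set U = (b_x·c_x, d_x·f_x)_1, V = (a_x·c_x, d_x·e_x)_1, W = (a_x·b_x, e_x·f_x)_1, with ψ(U,V,W) = 6·(U, V·W)_2 − U·(V,W)_2 and S = (da)(fc)(eb) − (ce)(bd)(af). Then ψ(U,V,W) = (3/4)·(cd)·(bf)·S · a_x·e_x, as an identity of polynomials in x1, x2 and the twelve coefficients a1, a2, …, f1, f2. -/
open MvPolynomial

/-- The `r`-th transvectant of binary forms `G`, `H` of degrees `m`, `n`: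
`(G,H)_r = ((m−r)!(n−r)!)/(m!·n!) · Σ_{i=0}^{r} (−1)^i·C(r,i)·
  (∂^r G/∂x1^{r−i}∂x2^{i})·(∂^r H/∂x1^{i}∂x2^{r−i})`. -/
noncomputable def transvectant {k : Type*} [Field k] (m n r : ℕ)
    (G H : MvPolynomial (Fin 2) k) : MvPolynomial (Fin 2) k :=
  C ((((m - r).factorial * (n - r).factorial : ℕ) : k) /
      ((m.factorial * n.factorial : ℕ) : k)) *
    ∑ i ∈ Finset.range (r + 1),
      C ((-1 : k) ^ i * (r.choose i : k)) *
        ((fun p => pderiv (0 : Fin 2) p)^[r - i]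
            ((fun p => pderiv (1 : Fin 2) p)^[i] G) *
          (fun p => pderiv (0 : Fin 2) p)^[i]
            ((fun p => pderiv (1 : Fin 2) p)^[r - i] H))

/-- The linear binary form `u1·x1 + u2·x2`. -/
noncomputable def linForm {k : Type*} [Field k] (u1 u2 : k) : MvPolynomial (Fin 2) k :=
  C u1 * X 0 + C u2 * X 1

/-- The binary quadratic form `p·x1² + q·x1·x2 + r·x2²`. -/
noncomputable def quadForm {k : Type*} [Field k] (p q r : k) : MvPolynomial (Fin 2) k :=
  C p * X 0 ^ 2 + C q * (X 0 * X 1) + C r * X 1 ^ 2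

/-- The binary quartic form with coefficients `h0, …, h4`, in decreasing powers of `x1`. -/
noncomputable def quarticForm {k : Type*} [Field k] (h0 h1 h2 h3 h4 : k) :
    MvPolynomial (Fin 2) k :=
  C h0 * X 0 ^ 4 + C h1 * (X 0 ^ 3 * X 1) + C h2 * (X 0 ^ 2 * X 1 ^ 2) +
    C h3 * (X 0 * X 1 ^ 3) + C h4 * X 1 ^ 4

section BinaryForms

variable {k : Type*} [Field k]

lemma C_ofNat (n : ℕ) [n.AtLeastTwo] :
    (C (ofNat(n) : k) : MvPolynomial (Fin 2) k) = ofNat(n) :=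
  map_ofNat C n

lemma pderiv_ofNat (i : Fin 2) (n : ℕ) [n.AtLeastTwo] :
    pderiv i (ofNat(n) : MvPolynomial (Fin 2) k) = 0 :=
  (pderiv i).map_natCast n

lemma linForm_mul_linForm (u1 u2 v1 v2 : k) :
    linForm u1 u2 * linForm v1 v2 = quadForm (u1 * v1) (u1 * v2 + u2 * v1) (u2 * v2) := by
  simp only [linForm, quadForm, map_mul, map_add]
  ring

lemma quadForm_mul_quadForm (p q r p' q' r' : k) :
    quadForm p q r * quadForm p' q' r' =
      quarticForm (p * p') (p * q' + q * p') (p * r' + q * q' + r * p') (q * r' + r * q')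
        (r * r') := by
  simp only [quarticForm, quadForm, map_mul, map_add]
  ring

lemma C_mul_quadForm (s p q r : k) :
    C s * quadForm p q r = quadForm (s * p) (s * q) (s * r) := by
  simp only [quadForm, map_mul]
  ring

lemma quadForm_add (p q r p' q' r' : k) :
    quadForm p q r + quadForm p' q' r' = quadForm (p + p') (q + q') (r + r') := by
  simp only [quadForm, map_add]
  ring

lemma quadForm_sub (p q r p' q' r' : k) :
    quadForm p q r - quadForm p' q' r' = quadForm (p - p') (q - q') (r - r') := by
  simp only [quadForm, map_sub]
  ring

lemma pderiv_zero_linForm (u1 u2 : k) : pderiv 0 (linForm u1 u2) = C u1 := by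
  simp [linForm, pderiv_X]

lemma pderiv_one_linForm (u1 u2 : k) : pderiv 1 (linForm u1 u2) = C u2 := by
  simp [linForm, pderiv_X]

lemma pderiv_zero_quadForm (p q r : k) : pderiv 0 (quadForm p q r) = linForm (2 * p) q := by
  simp [linForm, quadForm, C_ofNat, pderiv_X]
  ring

lemma pderiv_one_quadForm (p q r : k) : pderiv 1 (quadForm p q r) = linForm q (2 * r) := by
  simp [linForm, quadForm, C_ofNat, pderiv_X]
  ring

lemma pderiv_zero_pderiv_zero_quarticForm (h0 h1 h2 h3 h4 : k) :
    pderiv 0 (pderiv 0 (quarticForm h0 h1 h2 h3 h4)) =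
      quadForm (12 * h0) (6 * h1) (2 * h2) := by
  simp [quarticForm, quadForm, C_ofNat, pderiv_ofNat, pderiv_X]
  ring

lemma pderiv_zero_pderiv_one_quarticForm (h0 h1 h2 h3 h4 : k) :
    pderiv 0 (pderiv 1 (quarticForm h0 h1 h2 h3 h4)) =
      quadForm (3 * h1) (4 * h2) (3 * h3) := by
  simp [quarticForm, quadForm, C_ofNat, pderiv_ofNat, pderiv_X]
  ring

lemma pderiv_one_pderiv_one_quarticForm (h0 h1 h2 h3 h4 : k) :
    pderiv 1 (pderiv 1 (quarticForm h0 h1 h2 h3 h4)) =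
      quadForm (2 * h2) (6 * h3) (12 * h4) := by
  simp [quarticForm, quadForm, C_ofNat, pderiv_ofNat, pderiv_X]
  ring

variable [CharZero k]

lemma transvectant_one_quadForm (p q r p' q' r' : k) :
    transvectant 2 2 1 (quadForm p q r) (quadForm p' q' r') =
      quadForm ((p * q' - q * p') / 2) (p * r' - r * p') ((q * r' - r * q') / 2) := by
  simp only [transvectant, Finset.sum_range_succ, Finset.sum_range_zero, Function.iterate_succ,
    Function.iterate_zero, Function.comp_apply, id_eq, Nat.sub_self, Nat.sub_zero, zero_add,
    pderiv_zero_quadForm, pderiv_one_quadForm, linForm_mul_linForm, C_mul_quadForm, quadForm_add]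
  congr 1 <;> norm_num [Nat.factorial] <;> ring

lemma transvectant_two_quadForm (p q r p' q' r' : k) :
    transvectant 2 2 2 (quadForm p q r) (quadForm p' q' r') =
      C (p * r' + r * p' - q * q' / 2) := by
  simp only [transvectant, Finset.sum_range_succ, Finset.sum_range_zero, Function.iterate_succ,
    Function.iterate_zero, Function.comp_apply, id_eq, Nat.sub_self, Nat.sub_zero, zero_add,
    Nat.reduceSub, Nat.reduceAdd,
    pderiv_zero_quadForm, pderiv_one_quadForm, pderiv_zero_linForm, pderiv_one_linForm,
    ← map_mul, ← map_add]
  congr 1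
  norm_num [Nat.factorial]
  ring

lemma transvectant_two_quadForm_quarticForm (p q r h0 h1 h2 h3 h4 : k) :
    transvectant 2 4 2 (quadForm p q r) (quarticForm h0 h1 h2 h3 h4) =
      quadForm ((2 * p * h2 - 3 * q * h1 + 12 * r * h0) / 12)
        ((6 * p * h3 - 4 * q * h2 + 6 * r * h1) / 12)
        ((12 * p * h4 - 3 * q * h3 + 2 * r * h2) / 12) := by
  simp only [transvectant, Finset.sum_range_succ, Finset.sum_range_zero, Function.iterate_succ,
    Function.iterate_zero, Function.comp_apply, id_eq, Nat.sub_self, Nat.sub_zero, zero_add,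
    Nat.reduceSub, Nat.reduceAdd,
    pderiv_zero_quadForm, pderiv_one_quadForm, pderiv_zero_linForm, pderiv_one_linForm,
    pderiv_zero_pderiv_zero_quarticForm, pderiv_zero_pderiv_one_quarticForm,
    pderiv_one_pderiv_one_quarticForm, C_mul_quadForm, quadForm_add]
  congr 1 <;> norm_num [Nat.factorial] <;> ring

end BinaryForms

/-- For six linear binary forms over a field of characteristic zero, with
`U = (b_x·c_x, d_x·f_x)_1`, `V = (a_x·c_x, d_x·e_x)_1`, `W = (a_x·b_x, e_x·f_x)_1`,
`ψ(U,V,W) = 6·(U,V·W)_2 − U·(V,W)_2` and `S = (da)(fc)(eb) − (ce)(bd)(af)`, one has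
`ψ(U,V,W) = (3/4)·(cd)·(bf)·S · a_x·e_x`, identically in the twelve coefficients. -/
theorem pascal_stmt_7 {k : Type*} [Field k] [CharZero k]
    (a1 a2 b1 b2 c1 c2 d1 d2 e1 e2 f1 f2 : k) :
    let ax := linForm a1 a2
    let bx := linForm b1 b2
    let cx := linForm c1 c2
    let dx := linForm d1 d2
    let ex := linForm e1 e2
    let fx := linForm f1 f2
    let U := transvectant 2 2 1 (bx * cx) (dx * fx)
    let V := transvectant 2 2 1 (ax * cx) (dx * ex)
    let W := transvectant 2 2 1 (ax * bx) (ex * fx)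
    let S := (d1 * a2 - d2 * a1) * (f1 * c2 - f2 * c1) * (e1 * b2 - e2 * b1) -
      (c1 * e2 - c2 * e1) * (b1 * d2 - b2 * d1) * (a1 * f2 - a2 * f1)
    C (6 : k) * transvectant 2 4 2 U (V * W) - U * transvectant 2 2 2 V W =
      C ((3 / 4) * (c1 * d2 - c2 * d1) * (b1 * f2 - b2 * f1) * S) * (ax * ex) := by
  intro ax bx cx dx ex fx U V W S
  simp only [U, V, W, S, ax, bx, cx, dx, ex, fx, linForm_mul_linForm, transvectant_one_quadForm,
    quadForm_mul_quadForm, transvectant_two_quadForm, transvectant_two_quadForm_quarticForm,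
    mul_comm (quadForm _ _ _) (C _), C_mul_quadForm, quadForm_sub]
  congr 1 <;> ring
end
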